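/- arXiv:2312.11132 — 2 statements merged into one kernel-verified Lean document; each statement's English description precedes it below -/
import Mathlib

section
/- Let R : ℝ^d → ℝ be an asset exposure risk measure and let V be a linear subspace of ℝ^d. For every y ∈ ℝ^d, the minimizer of u ↦ R(y+u) over V is unique: if u₁*, u₂* ∈ V satisfy R(y+u₁*) = R(y+u₂*) = inf_{u ∈ V} R(y+u), then u₁* = u₂*. (If y ∈ V the unique minimizer is u* = −y; if y ∉ V uniqueness follows from the equality case of subadditivity.) -/
noncomputable section

open Filter

/-- An asset exposure risk measure on `ℝ^d`: continuous, C¹ away from 0,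
positively homogeneous, subadditive, positive on nonzero vectors, and
additive only under scaled exposures. -/
structure IsAssetRiskMeasure {d : ℕ} (R : EuclideanSpace ℝ (Fin d) → ℝ) : Prop where
  continuous : Continuous R
  contDiffAt : ∀ y : EuclideanSpace ℝ (Fin d), y ≠ 0 → ContDiffAt ℝ 1 R y
  pos_hom : ∀ l : ℝ, 0 ≤ l → ∀ y, R (l • y) = l * R y
  subadd : ∀ y₁ y₂, R (y₁ + y₂) ≤ R y₁ + R y₂
  pos : ∀ y, y ≠ 0 → 0 < R y
  add_eq : ∀ y₁ y₂, y₁ ≠ 0 → y₂ ≠ 0 →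
    R (y₁ + y₂) = R y₁ + R y₂ → ∃ c : ℝ, 0 < c ∧ y₁ = c • y₂

/-- the minimizer of u ↦ R(y+u) over a linear subspace V is unique. -/
theorem stmt_2 {d : ℕ} (R : EuclideanSpace ℝ (Fin d) → ℝ)
    (hR : IsAssetRiskMeasure R) (V : Submodule ℝ (EuclideanSpace ℝ (Fin d)))
    (y u₁ u₂ : EuclideanSpace ℝ (Fin d)) (hu₁ : u₁ ∈ V) (hu₂ : u₂ ∈ V)
    (hmin₁ : ∀ u ∈ V, R (y + u₁) ≤ R (y + u))
    (hmin₂ : ∀ u ∈ V, R (y + u₂) ≤ R (y + u)) :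
    u₁ = u₂ := by
  have hR0 : R 0 = 0 := by simpa using hR.pos_hom 0 le_rfl 0
  have heq : R (y + u₁) = R (y + u₂) := le_antisymm (hmin₁ u₂ hu₂) (hmin₂ u₁ hu₁)
  have eq_zero {x : EuclideanSpace ℝ (Fin d)} (hx : R x = 0) : x = 0 := by
    by_contra h
    exact (hR.pos x h).ne' hx
  suffices h : y + u₁ = y + u₂ from add_left_cancel h
  by_cases h₁ : y + u₁ = 0
  · rw [h₁, eq_zero (heq.symm.trans (h₁ ▸ hR0))]
  by_cases h₂ : y + u₂ = 0
  · rw [h₂, eq_zero (heq.trans (h₂ ▸ hR0))]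
  have hmid : R (y + u₁) ≤ (1 / 2) * R ((y + u₁) + (y + u₂)) := by
    rw [← hR.pos_hom (1 / 2) (by norm_num)]
    convert hmin₁ ((1 / 2 : ℝ) • (u₁ + u₂)) (V.smul_mem _ (V.add_mem hu₁ hu₂)) using 2
    module
  have hadd : R ((y + u₁) + (y + u₂)) = R (y + u₁) + R (y + u₂) :=
    le_antisymm (hR.subadd _ _) (by linarith)
  obtain ⟨c, hc, hcu⟩ := hR.add_eq _ _ h₁ h₂ hadd
  have hc1 : c = 1 := by
    have hscale : c * R (y + u₂) = R (y + u₂) := by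
      rw [← hR.pos_hom c hc.le, ← hcu, heq]
    exact (mul_eq_right₀ (hR.pos _ h₂).ne').mp hscale
  rw [hcu, hc1, one_smul]
end
end

section
/- Let R : ℝ^d → ℝ be an asset exposure risk measure, let V be a linear subspace of ℝ^d, and define F(y) = inf_{u ∈ V} R(y+u). For every y ∈ ℝ^d ∖ V, the function F is differentiable at y with gradient ∇F(y) = ∇R(y + u*(y)), where u*(y) ∈ V is the unique minimizer of u ↦ R(y+u) over V; moreover y ↦ ∇F(y) is continuous on ℝ^d ∖ V. -/
noncomputable section

open Filter

namespace IsAssetRiskMeasure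

variable {d : ℕ} {R : EuclideanSpace ℝ (Fin d) → ℝ}

theorem convexOn (hR : IsAssetRiskMeasure R) : ConvexOn ℝ Set.univ R := by
  refine ⟨convex_univ, fun x _ y _ a b ha hb _ => ?_⟩
  refine (hR.subadd _ _).trans ?_
  rw [hR.pos_hom a ha, hR.pos_hom b hb, smul_eq_mul, smul_eq_mul]

theorem map_zero (hR : IsAssetRiskMeasure R) : R 0 = 0 := by
  simpa using hR.pos_hom 0 le_rfl 0

theorem exists_mul_norm_le (hR : IsAssetRiskMeasure R) :
    ∃ a : ℝ, 0 < a ∧ ∀ y, a * ‖y‖ ≤ R y := by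
  rcases (Metric.sphere (0 : EuclideanSpace ℝ (Fin d)) 1).eq_empty_or_nonempty with h | h
  · refine ⟨1, one_pos, fun y => ?_⟩
    rcases eq_or_ne y 0 with rfl | hy
    · simp [hR.map_zero]
    · have hmem : ‖y‖⁻¹ • y ∈ Metric.sphere (0 : EuclideanSpace ℝ (Fin d)) 1 := by
        simp [norm_smul, hy]
      simp [h] at hmem
  · obtain ⟨x, hx, hmin⟩ := (isCompact_sphere _ _).exists_isMinOn h hR.continuous.continuousOn
    have hx0 : x ≠ 0 := by
      rintro rfl
      simp at hx
    refine ⟨R x, hR.pos x hx0, fun y => ?_⟩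
    rcases eq_or_ne y 0 with rfl | hy
    · simp [hR.map_zero]
    · have hmem : ‖y‖⁻¹ • y ∈ Metric.sphere (0 : EuclideanSpace ℝ (Fin d)) 1 := by
        simp [norm_smul, hy]
      have hle : R x ≤ R (‖y‖⁻¹ • y) := hmin hmem
      rw [hR.pos_hom _ (by positivity)] at hle
      have hpos : 0 < ‖y‖ := norm_pos_iff.mpr hy
      calc R x * ‖y‖ ≤ ‖y‖⁻¹ * R y * ‖y‖ := by gcongr
        _ = R y := by field_simp

theorem hasFDerivAt (hR : IsAssetRiskMeasure R) {p : EuclideanSpace ℝ (Fin d)} (hp : p ≠ 0) :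
    HasFDerivAt R (fderiv ℝ R p) p :=
  ((hR.contDiffAt p hp).differentiableAt (by norm_num)).hasFDerivAt

theorem hasDerivAt_line (hR : IsAssetRiskMeasure R) {p : EuclideanSpace ℝ (Fin d)} (hp : p ≠ 0)
    (h : EuclideanSpace ℝ (Fin d)) :
    HasDerivAt (fun t : ℝ => R (p + t • h)) (fderiv ℝ R p h) 0 :=
  (hR.hasFDerivAt hp).hasLineDerivAt h

theorem fderiv_le_sub (hR : IsAssetRiskMeasure R) {p : EuclideanSpace ℝ (Fin d)} (hp : p ≠ 0)
    (h : EuclideanSpace ℝ (Fin d)) : fderiv ℝ R p h ≤ R (p + h) - R p := by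
  have hconv : ConvexOn ℝ Set.univ (fun t : ℝ => R (p + t • h)) := by
    refine ⟨convex_univ, fun x _ y _ a b ha hb hab => ?_⟩
    have heq : p + (a • x + b • y) • h = a • (p + x • h) + b • (p + y • h) := by
      obtain rfl : b = 1 - a := by linarith
      module
    simpa only [heq] using hR.convexOn.2 (Set.mem_univ _) (Set.mem_univ _) ha hb hab
  simpa [slope_def_field] using hconv.le_slope_of_hasDerivAt (Set.mem_univ 0) (Set.mem_univ 1)
    one_pos (hR.hasDerivAt_line hp h)

theorem fderiv_eq_zero_of_forall_le (hR : IsAssetRiskMeasure R)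
    {V : Submodule ℝ (EuclideanSpace ℝ (Fin d))} {p : EuclideanSpace ℝ (Fin d)} (hp : p ≠ 0)
    (hmin : ∀ u ∈ V, R p ≤ R (p + u)) {u : EuclideanSpace ℝ (Fin d)} (hu : u ∈ V) :
    fderiv ℝ R p u = 0 := by
  refine IsLocalMin.hasDerivAt_eq_zero ?_ (hR.hasDerivAt_line hp u)
  refine Eventually.of_forall fun t => ?_
  simpa using hmin (t • u) (V.smul_mem t hu)

theorem eq_of_forall_le (hR : IsAssetRiskMeasure R)
    {V : Submodule ℝ (EuclideanSpace ℝ (Fin d))} {p q : EuclideanSpace ℝ (Fin d)}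
    (hp : p ∉ V) (hpq : q - p ∈ V) (hminp : ∀ u ∈ V, R p ≤ R (p + u)) (hq : R q ≤ R p) :
    q = p := by
  have hp0 : p ≠ 0 := fun h => hp (h ▸ V.zero_mem)
  have hq0 : q ≠ 0 := by
    rintro rfl
    exact hp (by simpa using hpq)
  have hmid := hminp ((1 / 2 : ℝ) • (q - p)) (V.smul_mem _ hpq)
  rw [show p + (1 / 2 : ℝ) • (q - p) = (1 / 2 : ℝ) • (q + p) by module,
    hR.pos_hom _ (by norm_num)] at hmid
  have hsub := hR.subadd q p
  have hqp : R p ≤ R q := by simpa using hminp _ hpq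
  obtain ⟨c, hc, rfl⟩ := hR.add_eq q p hq0 hp0 (by linarith)
  have hRc : c * R p = R p := by
    rw [← hR.pos_hom c hc.le]
    exact le_antisymm hq hqp
  rw [mul_eq_right₀ (hR.pos p hp0).ne'] at hRc
  rw [hRc, one_smul]

theorem continuousAt_minimizer (hR : IsAssetRiskMeasure R)
    {V : Submodule ℝ (EuclideanSpace ℝ (Fin d))}
    {ustar : EuclideanSpace ℝ (Fin d) → EuclideanSpace ℝ (Fin d)}
    (hustar : ∀ y ∉ V, ustar y ∈ V ∧ ∀ u ∈ V, R (y + ustar y) ≤ R (y + u))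
    {y : EuclideanSpace ℝ (Fin d)} (hy : y ∉ V) :
    ContinuousAt (fun z => z + ustar z) y := by
  have hclosed : IsClosed (V : Set (EuclideanSpace ℝ (Fin d))) := V.closed_of_finiteDimensional
  have hnear : ∀ᶠ z in nhds y, z ∉ V := hclosed.isOpen_compl.mem_nhds hy
  obtain ⟨a, ha, hcoer⟩ := hR.exists_mul_norm_le
  have hbdd : ∀ᶠ z in nhds y,
      z + ustar z ∈ Metric.closedBall (0 : EuclideanSpace ℝ (Fin d)) ((R y + 1) / a) := by
    filter_upwards [hnear, hR.continuous.continuousAt.eventually_lt_const (lt_add_one (R y))]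
      with z hz hRz
    rw [mem_closedBall_zero_iff, le_div_iff₀ ha, mul_comm]
    have hmin := (hustar z hz).2 0 V.zero_mem
    rw [add_zero] at hmin
    exact (hcoer _).trans (hmin.trans hRz.le)
  refine tendsto_iff_ultrafilter _ _ _ |>.mpr fun g hg => ?_
  obtain ⟨q, -, hq⟩ := (isCompact_closedBall (0 : EuclideanSpace ℝ (Fin d))
    ((R y + 1) / a)).ultrafilter_le_nhds (g.map fun z => z + ustar z)
    (le_principal_iff.mpr (hg hbdd))
  have hq' : Tendsto (fun z => z + ustar z) g (nhds q) := hq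
  have hid : Tendsto (fun z => z) (g : Filter (EuclideanSpace ℝ (Fin d))) (nhds y) := hg
  have hle : ∀ u ∈ V, R q ≤ R (y + u) := fun u hu =>
    le_of_tendsto_of_tendsto ((hR.continuous.tendsto q).comp hq')
      ((hR.continuous.tendsto (y + u)).comp (hid.add_const u))
      (hg (hnear.mono fun z hz => (hustar z hz).2 u hu))
  have hqV : q - y ∈ V := by
    refine hclosed.mem_of_tendsto (hq'.sub hid) (hg (hnear.mono fun z hz => ?_))
    simpa using (hustar z hz).1
  obtain ⟨huV, hmin⟩ := hustar y hy
  have heq : q = y + ustar y := by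
    refine hR.eq_of_forall_le (V := V) ?_ ?_ (fun u hu => ?_) (hle _ huV)
    · rwa [V.add_mem_iff_left huV]
    · rw [← sub_sub]
      exact V.sub_mem hqV huV
    · rw [add_assoc]
      exact hmin _ (V.add_mem huV hu)
  rw [heq] at hq'
  exact hq'

theorem continuousAt_gradient (hR : IsAssetRiskMeasure R) {p : EuclideanSpace ℝ (Fin d)}
    (hp : p ≠ 0) : ContinuousAt (gradient R) p :=
  (InnerProductSpace.toDual ℝ _).symm.continuous.continuousAt.comp
    ((hR.contDiffAt p hp).continuousAt_fderiv (by norm_num))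

end IsAssetRiskMeasure

/-- on ℝ^d ∖ V, F is differentiable with gradient ∇R(y + u*(y)), and this
gradient map is continuous on ℝ^d ∖ V. -/
theorem stmt_5 {d : ℕ} (R : EuclideanSpace ℝ (Fin d) → ℝ)
    (hR : IsAssetRiskMeasure R) (V : Submodule ℝ (EuclideanSpace ℝ (Fin d)))
    (F : EuclideanSpace ℝ (Fin d) → ℝ)
    (hF : ∀ y, F y = sInf ((fun u => R (y + u)) '' (V : Set (EuclideanSpace ℝ (Fin d)))))
    (ustar : EuclideanSpace ℝ (Fin d) → EuclideanSpace ℝ (Fin d))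
    (hustar : ∀ y ∉ (V : Set (EuclideanSpace ℝ (Fin d))), ustar y ∈ V ∧
      ∀ u ∈ V, R (y + ustar y) ≤ R (y + u)) :
    (∀ y ∉ (V : Set (EuclideanSpace ℝ (Fin d))),
        HasGradientAt F (gradient R (y + ustar y)) y) ∧
      ContinuousOn (fun y => gradient R (y + ustar y))
        ((V : Set (EuclideanSpace ℝ (Fin d)))ᶜ) := by
  have hF_eq : ∀ y ∉ V, F y = R (y + ustar y) := fun y hy => by
    rw [hF]
    refine IsLeast.csInf_eq ⟨⟨ustar y, (hustar y hy).1, rfl⟩, ?_⟩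
    rintro _ ⟨u, hu, rfl⟩
    exact (hustar y hy).2 u hu
  have hne : ∀ y ∉ V, y + ustar y ≠ 0 := fun y hy h =>
    hy ((V.add_mem_iff_left (hustar y hy).1).mp (h ▸ V.zero_mem))
  refine ⟨fun y hy => ?_, fun y hy => ?_⟩
  · obtain ⟨huV, hmin⟩ := hustar y hy
    have hp := hne y hy
    have hcrit : ∀ v ∈ V, fderiv ℝ R (y + ustar y) v = 0 := fun v hv =>
      hR.fderiv_eq_zero_of_forall_le hp
        (fun u hu => by
          rw [add_assoc]
          exact hmin _ (V.add_mem huV hu)) hv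
    have hnear : ∀ᶠ z in nhds y, z ∉ V :=
      V.closed_of_finiteDimensional.isOpen_compl.mem_nhds hy
    have hshift : HasFDerivAt (fun z => R (z + ustar y)) (fderiv ℝ R (y + ustar y)) y :=
      (hasFDerivAt_comp_add_right (ustar y)).mpr (hR.hasFDerivAt hp)
    rw [hasGradientAt_iff_hasFDerivAt, gradient, LinearIsometryEquiv.apply_symm_apply]
    refine .of_isLittleO (Asymptotics.IsBigO.trans_isLittleO (.of_bound 1 ?_) hshift.isLittleO)
    filter_upwards [hnear] with z hz
    have hupper := (hustar z hz).2 _ huV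
    have hlower := hR.fderiv_le_sub hp ((z - y) + (ustar z - ustar y))
    rw [map_add, hcrit _ (V.sub_mem (hustar z hz).1 huV),
      show y + ustar y + (z - y + (ustar z - ustar y)) = z + ustar z by abel] at hlower
    rw [hF_eq z hz, hF_eq y hy, one_mul, Real.norm_eq_abs, Real.norm_eq_abs]
    exact abs_le_abs_of_nonneg (by linarith) (by linarith)
  · exact (ContinuousAt.comp (f := fun z => z + ustar z) (hR.continuousAt_gradient (hne y hy))
      (hR.continuousAt_minimizer hustar hy)).continuousWithinAt
end
end
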